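/- Let C be a proper minor-closed class of finite simple graphs. Then for every positive integer p there is an integer g such that every graph G ∈ C with girth at least g satisfies χ_p(G) ≤ p + 2. -/

import Mathlib

open SimpleGraph ENNReal

universe u

/-- `H` is a shallow minor of `G` at depth `r`: there are pairwise disjoint branch sets
`A i ⊆ V(G)`, each inducing a connected subgraph of radius at most `r` (witnessed by a
center joined to every vertex of the branch set by a walk of length at most `r` inside it),
such that adjacency in `H` is witnessed by an edge of `G` between the branch sets. -/
def SimpleGraph.IsShallowMinor {V : Type u} (G : SimpleGraph V) (r : ℕ)
    {h : ℕ} (H : SimpleGraph (Fin h)) : Prop :=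
  ∃ A : Fin h → Set V,
    (Pairwise fun i j => Disjoint (A i) (A j)) ∧
    (∀ i, ∃ c : A i, ∀ v : A i, ∃ w : (G.induce (A i)).Walk c v, w.length ≤ r) ∧
    (∀ i j, H.Adj i j → ∃ a ∈ A i, ∃ b ∈ A j, G.Adj a b)

/-- The grad (greatest reduced average density) `∇_r(G)`: supremum of `‖H‖/|H|` over the
shallow minors `H` of `G` at depth `r`. -/
noncomputable def SimpleGraph.nabla {V : Type u} (G : SimpleGraph V) (r : ℕ) : ℝ≥0∞ :=
  sSup {x : ℝ≥0∞ | ∃ (h : ℕ) (H : SimpleGraph (Fin h)), 0 < h ∧ G.IsShallowMinor r H ∧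
    x = (Nat.card H.edgeSet : ℝ≥0∞) / (h : ℝ≥0∞)}

/-- A class of finite simple graphs, presented as a set of graphs on `Fin n` for varying `n`. -/
abbrev GraphClass : Type := Set ((n : ℕ) × SimpleGraph (Fin n))

/-- The expansion `Ex_C(r) = sup { ∇_r(G) : G ∈ C }` of a class of graphs. -/
noncomputable def GraphClass.expansion (C : GraphClass) (r : ℕ) : ℝ≥0∞ :=
  sSup {x : ℝ≥0∞ | ∃ G ∈ C, x = SimpleGraph.nabla G.2 r}

/-- Iterated deletion of internal vertices of long induced-degree-two paths, ending in a
forest.  `PathDegen G p H` means the subgraph `H` of `G` can be reduced to a forest by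
repeatedly deleting the internal vertices (all of degree two) of a path of length at
least `p`. -/
inductive SimpleGraph.PathDegen {V : Type u} (G : SimpleGraph V) (p : ℕ) : G.Subgraph → Prop
  | forest (H : G.Subgraph) (hH : H.coe.IsAcyclic) : PathDegen G p H
  | step (H : G.Subgraph) (l : List V) (hnd : l.Nodup)
      (hchain : l.Chain' H.Adj) (hlen : p + 1 ≤ l.length)
      (hdeg : ∀ v ∈ l.tail.dropLast, (H.neighborSet v).ncard = 2)
      (hrec : PathDegen G p (H.deleteVerts {v | v ∈ l.tail.dropLast})) :
      PathDegen G p H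

/-- A graph is `p`-path degenerate if it can be reduced to a forest by repeatedly deleting
the internal vertices, all of degree two, of paths of length at least `p`. -/
def SimpleGraph.IsPathDegenerate {V : Type u} (G : SimpleGraph V) (p : ℕ) : Prop :=
  G.PathDegen p ⊤

/-- A circular `(n,k)`-coloring: a map to `ℤ_n` sending adjacent vertices to elements at
circular distance at least `k`. -/
def SimpleGraph.IsCircularColoring {V : Type u} (G : SimpleGraph V) (n k : ℕ) : Prop :=
  ∃ f : V → ZMod n, ∀ u v, G.Adj u v → k ≤ (f u - f v).val ∧ (f u - f v).val ≤ n - k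

/-- The circular chromatic number: the infimum of the rationals `n/k` such that `G` has a
circular `(n,k)`-coloring. -/
noncomputable def SimpleGraph.circChromNum {V : Type u} (G : SimpleGraph V) : ℝ :=
  sInf {x : ℝ | ∃ n k : ℕ, 0 < n ∧ 0 < k ∧ G.IsCircularColoring n k ∧ x = (n : ℝ) / (k : ℝ)}

/-- `o` is an orientation of `G`: every arc of `o` is an edge of `G`, and every edge of `G`
gets exactly one of its two possible directions. -/
def SimpleGraph.IsOrientation {V : Type u} (G : SimpleGraph V) (o : V → V → Prop) : Prop :=
  (∀ u v, o u v → G.Adj u v) ∧ (∀ u v, G.Adj u v → (o u v ↔ ¬ o v u))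

/-- The oriented chromatic number: the least `k` such that every orientation of `G` admits a
homomorphism into some loopless digraph on `k` vertices. -/
noncomputable def SimpleGraph.orientedChromNum {V : Type u} (G : SimpleGraph V) : ℕ :=
  sInf {k : ℕ | ∀ o : V → V → Prop, G.IsOrientation o →
    ∃ D : Fin k → Fin k → Prop, Irreflexive D ∧
      ∃ f : V → Fin k, ∀ u v, o u v → D (f u) (f v)}

/-- The circulant digraph `C⃗_n^d`: vertex set `ℤ_n`, with an arc `(i,j)` whenever
`j - i ∈ {1, …, d}` (mod `n`). -/
def circulantDigraph (n d : ℕ) : ZMod n → ZMod n → Prop :=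
  fun i j => ∃ s : ℕ, 1 ≤ s ∧ s ≤ d ∧ j - i = (s : ZMod n)

/-- Tree-depth of `G`: the minimum height of a rooted forest (encoded as a strict partial
order on the vertices in which the set of strict ancestors of any vertex is a chain) all of
whose chains have at most `k` vertices, such that every edge of `G` joins two comparable
vertices. -/
noncomputable def SimpleGraph.treeDepth {V : Type u} [Fintype V] (G : SimpleGraph V) : ℕ :=
  sInf {k : ℕ | ∃ lt : V → V → Prop, Transitive lt ∧ Irreflexive lt ∧
    (∀ x y z, lt x z → lt y z → (lt x y ∨ lt y x ∨ x = y)) ∧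
    (∀ u v, G.Adj u v → lt u v ∨ lt v u) ∧
    (∀ s : Finset V, (∀ x ∈ s, ∀ y ∈ s, x = y ∨ lt x y ∨ lt y x) → s.card ≤ k)}

/-- The `p`-th chromatic number `χ_p(G)`: the least `N` such that `G` has a vertex coloring
with `N` colors in which, for every `i ≤ p`, the union of any `i` color classes induces a
subgraph of tree-depth at most `i`. -/
noncomputable def SimpleGraph.chiP {V : Type u} [Fintype V] (G : SimpleGraph V) (p : ℕ) : ℕ :=
  sInf {N : ℕ | ∃ c : V → Fin N, ∀ i : ℕ, i ≤ p → ∀ s : Finset (Fin N), s.card = i →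
    (G.induce {v | c v ∈ s}).treeDepth ≤ i}

/-- A `p`-centered coloring: every connected induced subgraph either has a color appearing
exactly once in it, or receives at least `p` distinct colors. -/
def SimpleGraph.IsCenteredColoring {V : Type u} (G : SimpleGraph V) (p : ℕ)
    {N : ℕ} (c : V → Fin N) : Prop :=
  ∀ s : Set V, (G.induce s).Connected →
    (∃ col : Fin N, {v ∈ s | c v = col}.ncard = 1) ∨ p ≤ (c '' s).ncard

/-- `H` is a minor of `G`: there are pairwise disjoint branch sets, each inducing a
connected subgraph of `G`, such that adjacency in `H` is witnessed by an edge of `G`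
between the corresponding branch sets. -/
def SimpleGraph.IsMinor {V : Type u} (G : SimpleGraph V) {h : ℕ} (H : SimpleGraph (Fin h)) : Prop :=
  ∃ A : Fin h → Set V,
    (Pairwise fun i j => Disjoint (A i) (A j)) ∧
    (∀ i, (G.induce (A i)).Connected) ∧
    (∀ i j, H.Adj i j → ∃ a ∈ A i, ∃ b ∈ A j, G.Adj a b)

/-- A minor-closed class of graphs. -/
def GraphClass.MinorClosed (C : GraphClass) : Prop :=
  ∀ G ∈ C, ∀ (h : ℕ) (H : SimpleGraph (Fin h)), (Sigma.snd G).IsMinor H → ⟨h, H⟩ ∈ C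

/-- The clique-grad `ω_r(G)`: the maximum clique number over the shallow minors of `G`
at depth `r`. -/
noncomputable def SimpleGraph.omegaMinor {V : Type u} (G : SimpleGraph V) (r : ℕ) : ℕ :=
  sSup {k : ℕ | ∃ (h : ℕ) (H : SimpleGraph (Fin h)), G.IsShallowMinor r H ∧
    ∃ s : Finset (Fin h), H.IsNClique k s}

namespace SimpleGraph

/-- A set `T` of vertices is connected in `G` if every nonempty part of `T` that is closed under
adjacency within `T` is all of `T`. The empty set is allowed. -/
def SetConn {V : Type*} (G : SimpleGraph V) (T : Set V) : Prop :=
  ∀ D ⊆ T, D.Nonempty → (∀ a ∈ D, ∀ b ∈ T, G.Adj a b → b ∈ D) → T ⊆ D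

/-- `G` has a complete minor on `n` vertices. -/
def HasCompleteMinor {V : Type*} (G : SimpleGraph V) (n : ℕ) : Prop :=
  ∃ A : Fin n → Set V, (Pairwise fun i j => Disjoint (A i) (A j)) ∧
    (∀ i, (A i).Nonempty ∧ G.SetConn (A i)) ∧
    (∀ i j, i ≠ j → ∃ a ∈ A i, ∃ b ∈ A j, G.Adj a b)

/-- The graph obtained from `G` by identifying vertices with the same image under `f`. -/
def contract {V W : Type*} (G : SimpleGraph V) (f : V → W) : SimpleGraph W where
  Adj a b := a ≠ b ∧ ∃ x y, G.Adj x y ∧ f x = a ∧ f y = b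
  symm := ⟨fun _ _ ⟨hne, x, y, h, hx, hy⟩ => ⟨hne.symm, y, x, h.symm, hy, hx⟩⟩
  loopless := ⟨fun _ h => h.1 rfl⟩

section Minor

variable {V W : Type*} {G : SimpleGraph V}

lemma setConn_singleton (v : V) : G.SetConn {v} := by
  rintro D hD ⟨d, hd⟩ -
  rw [Set.singleton_subset_iff, ← Set.mem_singleton_iff.1 (hD hd)]
  exact hd

lemma SetConn.preconnected_induce {T : Set V} (h : G.SetConn T) :
    (G.induce T).Preconnected := by
  intro a b
  have key := h {x | ∃ hx : x ∈ T, (G.induce T).Reachable a ⟨x, hx⟩} (fun x hx => hx.1)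
    ⟨a, a.2, Reachable.refl _⟩
    (fun x ⟨hx, hr⟩ y hy hxy => ⟨hy, hr.trans (Adj.reachable (by simpa using hxy))⟩)
  exact (key b.2).2

lemma SetConn.image_of_hom {H : SimpleGraph W} (φ : G →g H) {T : Set V} (h : G.SetConn T) :
    H.SetConn (φ '' T) := by
  rintro D hD ⟨d, hd⟩ hcl
  obtain ⟨t, ht, rfl⟩ := hD hd
  have key := h (T ∩ φ ⁻¹' D) Set.inter_subset_left ⟨t, ht, hd⟩
    (fun a ha b hb hab => ⟨hb, hcl _ ha.2 _ ⟨b, hb, rfl⟩ (φ.map_adj hab)⟩)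
  rintro _ ⟨x, hx, rfl⟩
  exact (key hx).2

lemma HasCompleteMinor.map {H : SimpleGraph W} (φ : G ↪g H) {n : ℕ}
    (h : G.HasCompleteMinor n) : H.HasCompleteMinor n := by
  obtain ⟨A, hdis, hconn, hadj⟩ := h
  refine ⟨fun i => φ '' A i, fun i j hij => ?_, fun i => ⟨(hconn i).1.image _,
    (hconn i).2.image_of_hom φ.toHom⟩, fun i j hij => ?_⟩
  · exact (Set.disjoint_image_iff φ.injective).2 (hdis hij)
  · obtain ⟨a, ha, b, hb, hab⟩ := hadj i j hij
    exact ⟨_, ⟨a, ha, rfl⟩, _, ⟨b, hb, rfl⟩, φ.map_adj_iff.2 hab⟩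

lemma HasCompleteMinor.of_contract {f : V → W} (hf : ∀ w, (f ⁻¹' {w}).Nonempty)
    (hconn : ∀ w, G.SetConn (f ⁻¹' {w})) {n : ℕ} (h : (G.contract f).HasCompleteMinor n) :
    G.HasCompleteMinor n := by
  obtain ⟨A, hdis, hA, hadj⟩ := h
  refine ⟨fun i => f ⁻¹' A i, fun i j hij => (hdis hij).preimage f, fun i => ⟨?_, ?_⟩,
    fun i j hij => ?_⟩
  · obtain ⟨w, hw⟩ := (hA i).1
    obtain ⟨x, hx⟩ := hf w
    exact ⟨x, by rw [Set.mem_preimage, Set.mem_singleton_iff.1 hx]; exact hw⟩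
  · rintro D hD ⟨d, hd⟩ hcl
    have hfib : ∀ x ∈ D, ∀ y, f y = f x → y ∈ D := by
      intro x hx y hy
      have := hconn (f x) (D ∩ f ⁻¹' {f x}) Set.inter_subset_right ⟨x, hx, rfl⟩
        (fun a ha b hb hab => ⟨hcl a ha.1 b (by
          have hb' : f b = f x := hb
          have := hD hx
          rwa [Set.mem_preimage, hb']) hab, hb⟩)
      exact (this hy).1
    have key := (hA i).2 (f '' D) (by rintro _ ⟨x, hx, rfl⟩; exact hD hx) ⟨f d, d, hd, rfl⟩ (by
      rintro _ ⟨x, hx, rfl⟩ b hb ⟨-, x', y', hxy, hx', rfl⟩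
      exact ⟨y', hcl x' (hfib x hx x' hx') y' hb hxy, rfl⟩)
    intro x hx
    obtain ⟨y, hy, hyx⟩ := key hx
    exact hfib y hy x hyx.symm
  · obtain ⟨_, ha, _, hb, -, x, y, hxy, rfl, rfl⟩ := hadj i j hij
    exact ⟨x, ha, y, hb, hxy⟩

lemma HasCompleteMinor.succ_of_neighborSet {v : V} {n : ℕ}
    (h : (G.induce (G.neighborSet v)).HasCompleteMinor n) : G.HasCompleteMinor (n + 1) := by
  obtain ⟨A, hdis, hA, hadj⟩ := h
  have hsub : ∀ i, ∀ x ∈ Subtype.val '' A i, G.Adj v x := by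
    rintro i _ ⟨x, -, rfl⟩; exact x.2
  refine ⟨Fin.cons {v} fun i => Subtype.val '' A i, ?_, ?_, ?_⟩
  · have h0 : ∀ i, Disjoint {v} (Subtype.val '' A i) := fun i =>
      Set.disjoint_singleton_left.2 fun hv => G.loopless.irrefl v (hsub i v hv)
    intro i j hij
    induction i using Fin.cases with
    | zero =>
      induction j using Fin.cases with
      | zero => exact absurd rfl hij
      | succ j => exact h0 j
    | succ i =>
      induction j using Fin.cases with
      | zero => exact (h0 i).symm
      | succ j =>
        exact (Set.disjoint_image_iff Subtype.val_injective).2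
          (hdis fun h => hij (congrArg Fin.succ h))
  · intro i
    induction i using Fin.cases with
    | zero => exact ⟨⟨v, rfl⟩, setConn_singleton v⟩
    | succ i => exact ⟨(hA i).1.image _, (hA i).2.image_of_hom (Embedding.induce _).toHom⟩
  · intro i j hij
    induction i using Fin.cases with
    | zero =>
      induction j using Fin.cases with
      | zero => exact absurd rfl hij
      | succ j =>
        obtain ⟨x, hx⟩ := (hA j).1
        exact ⟨v, rfl, x, ⟨x, hx, rfl⟩, x.2⟩
    | succ i =>
      induction j using Fin.cases with
      | zero =>
        obtain ⟨x, hx⟩ := (hA i).1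
        exact ⟨x, ⟨x, hx, rfl⟩, v, rfl, Adj.symm x.2⟩
      | succ j =>
        obtain ⟨a, ha, b, hb, hab⟩ := hadj i j fun h => hij (congrArg Fin.succ h)
        exact ⟨a, ⟨a, ha, rfl⟩, b, ⟨b, hb, rfl⟩, hab⟩

lemma HasCompleteMinor.isMinor {n : ℕ} (h : G.HasCompleteMinor n) (H : SimpleGraph (Fin n)) :
    G.IsMinor H := by
  obtain ⟨A, hdis, hA, hadj⟩ := h
  refine ⟨A, hdis, fun i => ?_, fun i j hij => hadj i j hij.ne⟩
  have := (hA i).1.to_subtype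
  exact ⟨(hA i).2.preconnected_induce⟩

open Classical in
/-- If contracting along `f` merges no two edges outside `B`, and every edge outside `B` has ends
with different images, then at most `B.card` edges are lost. -/
lemma card_edgeFinset_le_contract [Fintype V] [Fintype W] (f : V → W) (B : Finset (Sym2 V))
    (hB : ∀ x y, G.Adj x y → s(x, y) ∉ B → f x ≠ f y ∧
      ∀ x' y', G.Adj x' y' → s(x', y') ∉ B → f x = f x' → f y = f y' → x = x' ∧ y = y') :
    G.edgeFinset.card ≤ (G.contract f).edgeFinset.card + B.card := by
  have h1 : (G.edgeFinset \ B).card ≤ (G.contract f).edgeFinset.card := by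
    refine Finset.card_le_card_of_injOn (Sym2.map f) ?_ ?_
    · intro e he
      induction e with | _ x y
      simp only [Finset.coe_sdiff, Set.mem_sdiff, SetLike.mem_coe, mem_edgeFinset, mem_edgeSet] at he
      simp only [Sym2.map_mk, SetLike.mem_coe, mem_edgeFinset, mem_edgeSet]
      exact ⟨(hB x y he.1 he.2).1, x, y, he.1, rfl, rfl⟩
    · intro e he e' he' hee
      induction e with | _ x y
      induction e' with | _ x' y'
      simp only [Finset.coe_sdiff, Set.mem_sdiff, SetLike.mem_coe, mem_edgeFinset,
        mem_edgeSet] at he he'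
      simp only [Sym2.map_mk, Sym2.eq_iff] at hee
      rcases hee with ⟨h, h'⟩ | ⟨h, h'⟩
      · obtain ⟨rfl, rfl⟩ := (hB x y he.1 he.2).2 x' y' he'.1 he'.2 h h'
        rfl
      · obtain ⟨rfl, rfl⟩ := (hB x y he.1 he.2).2 y' x' he'.1.symm
          (by rw [Sym2.eq_swap]; exact he'.2) h h'
        exact Sym2.eq_swap
  have h2 := Finset.card_le_card_sdiff_add_card (s := G.edgeFinset) (t := B)
  omega

open Classical in
lemma two_pow_mul_card_le_of_forall_degree [Fintype V] {m : ℕ} (h : ∀ v, 2 * m ≤ G.degree v) :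
    m * Fintype.card V ≤ G.edgeFinset.card := by
  have h1 := G.sum_degrees_eq_twice_card_edges
  have h2 : Fintype.card V * (2 * m) ≤ ∑ v, G.degree v := by
    simpa using Finset.card_nsmul_le_sum Finset.univ (fun v => G.degree v) (2 * m) fun v _ => h v
  nlinarith

end Minor

open Classical in
/-- Theorem of Mader: graphs with many edges have large complete minors. -/
theorem hasCompleteMinor_of_card_edgeFinset (n : ℕ) : ∀ {V : Type u} [Fintype V] [Nonempty V]
    (G : SimpleGraph V), 2 ^ n * Fintype.card V ≤ G.edgeFinset.card → G.HasCompleteMinor n := by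
  induction n with
  | zero =>
    intro V _ _ G _
    exact ⟨fun i => i.elim0, fun i => i.elim0, fun i => i.elim0, fun i => i.elim0⟩
  | succ n ih =>
    intro V hV hV' G hG
    induction hk : Fintype.card V using Nat.strong_induction_on generalizing V with
    | _ k ihk
    by_cases hedge : ∃ u v, G.Adj u v ∧
        (G.neighborFinset u ∩ G.neighborFinset v).card + 1 ≤ 2 ^ (n + 1)
    · obtain ⟨u, v, huv, hcard⟩ := hedge
      let f : V → {x // x ≠ v} := fun x => if h : x = v then ⟨u, huv.ne⟩ else ⟨x, h⟩
      have hfv : f v = ⟨u, huv.ne⟩ := by simp [f]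
      have hf : ∀ x (h : x ≠ v), f x = ⟨x, h⟩ := fun x h => by simp [f, h]
      have hfeq : ∀ x y, f x = f y → x = y ∨ (x = u ∧ y = v) ∨ (x = v ∧ y = u) := by
        intro x y hxy
        by_cases hx : x = v <;> by_cases hy : y = v
        · left; rw [hx, hy]
        · subst hx; rw [hfv, hf y hy, Subtype.mk.injEq] at hxy; simp [hxy]
        · subst hy; rw [hfv, hf x hx, Subtype.mk.injEq] at hxy; simp [hxy]
        · rw [hf x hx, hf y hy, Subtype.mk.injEq] at hxy; exact .inl hxy
      have hW : Fintype.card {x // x ≠ v} + 1 = Fintype.card V := by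
        have := Fintype.card_pos (α := V)
        rw [Fintype.card_subtype_compl, Fintype.card_subtype_eq]
        omega
      have hne : Nonempty {x // x ≠ v} := ⟨⟨u, huv.ne⟩⟩
      refine HasCompleteMinor.of_contract (f := f) (fun w => ⟨w, hf w w.2⟩) ?_
        (ihk _ (by omega) (V := {x // x ≠ v}) (G.contract f) ?_ rfl)
      · rintro w D hD ⟨d, hd⟩ hcl x hx
        have hxd : f x = f d := by
          rw [Set.mem_singleton_iff.1 hx, Set.mem_singleton_iff.1 (hD hd)]
        rcases hfeq _ _ hxd with rfl | ⟨rfl, rfl⟩ | ⟨rfl, rfl⟩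
        · exact hd
        · exact hcl _ hd _ hx huv.symm
        · exact hcl _ hd _ hx huv
      · have hB := card_edgeFinset_le_contract (G := G) f
          (insert s(u, v) ((G.neighborFinset u ∩ G.neighborFinset v).image fun w => s(v, w))) (by
            intro x y hxy hxyB
            have hmem : ∀ a b, G.Adj a b → s(a, b) ∉ insert s(u, v)
                ((G.neighborFinset u ∩ G.neighborFinset v).image fun w => s(v, w)) →
                ¬ (a = u ∧ b = v) ∧ ¬ (a = v ∧ b = u) ∧ (a = v → ¬ G.Adj u b) ∧
                  (b = v → ¬ G.Adj u a) := by
              intro a b hab hB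
              simp only [Finset.mem_insert, Finset.mem_image, Finset.mem_inter,
                mem_neighborFinset, not_or, not_exists, not_and] at hB
              refine ⟨?_, ?_, ?_, ?_⟩
              · rintro ⟨rfl, rfl⟩; exact hB.1 rfl
              · rintro ⟨rfl, rfl⟩; exact hB.1 Sym2.eq_swap
              · rintro rfl h; exact hB.2 b ⟨h, hab⟩ rfl
              · rintro rfl h; exact hB.2 a ⟨h, hab.symm⟩ Sym2.eq_swap
            have h1 := hmem x y hxy hxyB
            refine ⟨fun h => ?_, fun x' y' hxy' hB' hx hy => ?_⟩
            · rcases hfeq _ _ h with h | h | h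
              · exact hxy.ne h
              · exact h1.1 h
              · exact h1.2.1 h
            · have h2 := hmem x' y' hxy' hB'
              rcases hfeq _ _ hx with rfl | ⟨rfl, rfl⟩ | ⟨rfl, rfl⟩ <;>
              rcases hfeq _ _ hy with rfl | ⟨rfl, rfl⟩ | ⟨rfl, rfl⟩ <;>
              grind [G.adj_comm, G.ne_of_adj])
        have hcard' := (Finset.card_insert_le s(u, v)
          ((G.neighborFinset u ∩ G.neighborFinset v).image fun w => s(v, w))).trans
          (Nat.add_le_add_right Finset.card_image_le 1)
        rw [← hW] at hG
        rw [Nat.mul_add] at hG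
        omega
    · push Not at hedge
      have hpos : 0 < G.edgeFinset.card := lt_of_lt_of_le (by positivity) hG
      obtain ⟨e, he⟩ := Finset.card_pos.1 hpos
      induction e with | _ v w
      have hvw : G.Adj v w := by simpa using he
      have hne : Nonempty (G.neighborSet v) := ⟨⟨w, hvw⟩⟩
      refine HasCompleteMinor.succ_of_neighborSet (v := v) (ih (G.induce (G.neighborSet v))
        (two_pow_mul_card_le_of_forall_degree fun x => ?_))
      have hx := hedge v x x.2
      rw [pow_succ] at hx
      rw [← card_neighborFinset_eq_degree]
      refine le_trans (by omega) (Finset.card_le_card_of_surjOn Subtype.val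
        (t := G.neighborFinset v ∩ G.neighborFinset x) ?_)
      intro y hy
      simp only [Finset.coe_inter, coe_neighborFinset, Set.mem_inter_iff,
        mem_neighborSet] at hy
      exact ⟨⟨y, hy.1⟩, by simpa using hy.2, rfl⟩

section Ear

variable {V : Type u} {G : SimpleGraph V}

lemma le_length_add_one_of_le_egirth {g : ℕ} (hg : (g : ℕ∞) ≤ G.egirth) {a b : V}
    (hab : G.Adj a b) (w : G.Walk b a) (hw : s(a, b) ∉ w.edges) : g ≤ w.length + 1 := by
  classical
  have hc : (Walk.cons hab w.bypass).IsCycle :=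
    (Walk.cons_isCycle_iff _ _).2 ⟨w.bypass_isPath, fun h => hw (w.edges_bypass_subset_edges h)⟩
  have h1 := le_egirth.1 hg _ _ hc
  have h2 := w.length_bypass_le_length
  rw [Walk.length_cons] at h1
  have h3 : g ≤ w.bypass.length + 1 := by exact_mod_cast h1
  omega

lemma exists_walk_of_seq {v : ℕ → V} (hv : ∀ i, G.Adj (v i) (v (i + 1))) (i n : ℕ) :
    ∃ w : G.Walk (v i) (v (i + n)), w.length = n ∧
      ∀ e ∈ w.edges, ∃ k, i ≤ k ∧ k < i + n ∧ e = s(v k, v (k + 1)) := by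
  induction n with
  | zero => exact ⟨Walk.nil, rfl, by simp⟩
  | succ n ih =>
    obtain ⟨w, hl, he⟩ := ih
    refine ⟨w.concat (hv (i + n)), by simp [hl], fun e h => ?_⟩
    rw [Walk.edges_concat, List.concat_eq_append, List.mem_append, List.mem_singleton] at h
    rcases h with h | rfl
    · obtain ⟨k, h1, h2, h3⟩ := he e h
      exact ⟨k, h1, by omega, h3⟩
    · exact ⟨i + n, by omega, by omega, rfl⟩

/-- Walks that never turn back do not revisit a vertex before `g` steps. -/
lemma le_of_nonbacktracking_of_eq {g : ℕ} (hg : (g : ℕ∞) ≤ G.egirth) {v : ℕ → V}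
    (hv : ∀ i, G.Adj (v i) (v (i + 1))) (hv' : ∀ i, v (i + 2) ≠ v i) (n : ℕ) :
    ∀ i, 0 < n → v i = v (i + n) → g ≤ n := by
  induction n using Nat.strong_induction_on with
  | _ n ih
  intro i hn hi
  by_contra! hlt
  have hne : ∀ k l, k < l → l < k + n → v k ≠ v l := fun k l hkl hl h => by
    have := ih (l - k) (by omega) k (by omega) (by rwa [Nat.add_sub_cancel' hkl.le])
    omega
  obtain ⟨m, rfl⟩ : ∃ m, n = m + 1 := ⟨n - 1, by omega⟩
  have hw := exists_walk_of_seq hv (i + 1) m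
  rw [show i + 1 + m = i + (m + 1) by omega, ← hi] at hw
  obtain ⟨w, hl, he⟩ := hw
  have := le_length_add_one_of_le_egirth hg (hv i) w fun hmem => by
    obtain ⟨k, hk, hk', hkeq⟩ := he _ hmem
    rcases Sym2.eq_iff.1 hkeq with ⟨h, -⟩ | ⟨h, h'⟩
    · exact hne i k (by omega) (by omega) h
    · rcases hk.eq_or_lt with rfl | hlt
      · exact hv' i h.symm
      · exact hne (i + 1) k hlt (by omega) h'
  omega

lemma exists_nonbacktracking_seq (hdeg : ∀ v a, ∃ b, G.Adj v b ∧ b ≠ a) (y : V) :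
    ∃ v : ℕ → V, v 0 = y ∧ (∀ i, G.Adj (v i) (v (i + 1))) ∧ ∀ i, v (i + 2) ≠ v i := by
  choose nxt h1 h2 using hdeg
  let step : V × V → V × V := fun q => (q.2, nxt q.2 q.1)
  have hs : ∀ i, (step^[i + 1] (y, y)) = step (step^[i] (y, y)) := fun i =>
    Function.iterate_succ_apply' _ _ _
  refine ⟨fun i => (step^[i] (y, y)).2, rfl, fun i => ?_, fun i => ?_⟩
  · simp only [hs]; exact h1 _ _
  · simp only [hs]; exact h2 _ _

/-- A partition into connected pieces of radius at most `2 * r`, each of which contains a ball of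
radius `r` about its centre, given by its set of centres `Y`, the map `f` to the centres, and the
parent map of the spanning trees. -/
lemma exists_ball_partition [Finite V] (G : SimpleGraph V) (r : ℕ) :
    ∃ (Y : Set V) (f par : V → V), (∀ x, f x ∈ Y) ∧ (∀ y ∈ Y, f y = y) ∧
      (∀ x ∉ Y, G.Adj x (par x) ∧ f (par x) = f x) ∧
      (∀ x, ∃ w : G.Walk x (f x), w.length ≤ 2 * r ∧
        ∀ e ∈ w.edges, ∃ z ∉ Y, e = s(z, par z)) ∧
      ∀ y ∈ Y, ∀ x, ∀ w : G.Walk y x, w.length ≤ r → f x = y := by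
  classical
  obtain ⟨Y, -, hY⟩ := Finite.exists_le_maximal
    (p := fun Y : Set V => ∀ y ∈ Y, ∀ z ∈ Y, ∀ w : G.Walk y z, w.length ≤ 2 * r → y = z)
    (a := ∅) (by simp)
  have hcov : ∀ x, ∃ y ∈ Y, ∃ w : G.Walk x y, w.length ≤ 2 * r := by
    intro x
    by_cases hx : x ∈ Y
    · exact ⟨x, hx, Walk.nil, by simp⟩
    by_contra! hcon
    refine hx (hY.2 (y := insert x Y) ?_ (Set.subset_insert x Y) (Set.mem_insert x Y))
    rintro y (rfl | hy) z (rfl | hz) w hw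
    · rfl
    · exact absurd hw (hcon z hz w).not_ge
    · exact absurd (by simpa using hw) (hcon y hy w.reverse).not_ge
    · exact hY.1 y hy z hz w hw
  have hex : ∀ x, ∃ k, ∃ y ∈ Y, ∃ w : G.Walk x y, w.length = k := fun x => by
    obtain ⟨y, hy, w, -⟩ := hcov x
    exact ⟨_, y, hy, w, rfl⟩
  let d : V → ℕ := fun x => Nat.find (hex x)
  have hd_le : ∀ x y (w : G.Walk x y), y ∈ Y → d x ≤ w.length := fun x y w hy =>
    Nat.find_min' (hex x) ⟨y, hy, w, rfl⟩
  have hd_r : ∀ x, d x ≤ 2 * r := fun x => by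
    obtain ⟨y, hy, w, hw⟩ := hcov x
    exact (hd_le x y w hy).trans hw
  have hdY : ∀ x ∈ Y, d x = 0 := fun x hx => by simpa using hd_le x x Walk.nil hx
  have hd0 : ∀ x, d x = 0 → x ∈ Y := fun x hx => by
    obtain ⟨y, hy, w, hw⟩ := Nat.find_spec (hex x)
    rw [show Nat.find (hex x) = 0 from hx] at hw
    rwa [Walk.eq_of_length_eq_zero hw]
  have hpar : ∀ x, ∃ x', (x ∈ Y → x' = x) ∧ (x ∉ Y → G.Adj x x' ∧ d x' + 1 ≤ d x) := by
    intro x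
    by_cases hx : x ∈ Y
    · exact ⟨x, fun _ => rfl, fun h => absurd hx h⟩
    obtain ⟨y, hy, w, hw⟩ := Nat.find_spec (hex x)
    cases w with
    | nil => exact absurd hy hx
    | cons h p =>
      refine ⟨_, fun h => absurd h hx, fun _ => ⟨h, ?_⟩⟩
      rw [show d x = _ from hw.symm, Walk.length_cons]
      exact Nat.add_le_add_right (hd_le _ _ p hy) 1
  choose par hparY hpar using hpar
  have hwalk : ∀ k x, d x ≤ k → par^[k] x ∈ Y ∧ ∃ w : G.Walk x (par^[k] x),
      w.length ≤ d x ∧ ∀ e ∈ w.edges, ∃ z ∉ Y, e = s(z, par z) := by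
    intro k
    induction k with
    | zero => exact fun x hx => ⟨hd0 x (Nat.le_zero.1 hx), Walk.nil, by simp, by simp⟩
    | succ k ih =>
      intro x hx
      rw [Function.iterate_succ_apply]
      by_cases hxY : x ∈ Y
      · rw [hparY x hxY]
        exact ih x (by rw [hdY x hxY]; omega)
      · obtain ⟨hadj, hlt⟩ := hpar x hxY
        obtain ⟨hm, w, hl, he⟩ := ih (par x) (by omega)
        refine ⟨hm, Walk.cons hadj w, by rw [Walk.length_cons]; omega, fun e h => ?_⟩
        rw [Walk.edges_cons, List.mem_cons] at h
        rcases h with rfl | h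
        · exact ⟨x, hxY, rfl⟩
        · exact he e h
  refine ⟨Y, par^[2 * r], par, fun x => (hwalk _ x (hd_r x)).1, fun y hy => ?_,
    fun x hx => ⟨(hpar x hx).1, ?_⟩, fun x => ?_, fun y hy x w hw => ?_⟩
  · exact Function.iterate_fixed (hparY y hy) _
  · rw [← Function.iterate_succ_apply, Function.iterate_succ_apply']
    exact hparY _ (hwalk _ x (hd_r x)).1
  · obtain ⟨-, w, hl, he⟩ := hwalk _ x (hd_r x)
    exact ⟨w, hl.trans (hd_r x), he⟩
  · obtain ⟨hm, w', hl, -⟩ := hwalk _ x (hd_r x)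
    have h1 := hd_le x y w.reverse hy
    rw [Walk.length_reverse] at h1
    refine (hY.1 y hy _ hm (w.append w') ?_).symm
    rw [Walk.length_append]
    omega

lemma mem_iff_mem_of_walk {D : Set V} {a b : V} (w : G.Walk a b)
    (h : ∀ x y, s(x, y) ∈ w.edges → x ∈ D → y ∈ D) : a ∈ D ↔ b ∈ D := by
  induction w with
  | nil => rfl
  | cons hadj p ih =>
    rw [← ih fun x y hxy => h x y (by simp [hxy])]
    exact ⟨h _ _ (by simp), h _ _ (by simp [Sym2.eq_swap])⟩

/-- Graphs of large girth and minimum degree at least two without a large complete minor contain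
a long path all of whose internal vertices have degree two. -/
theorem exists_long_ear [Finite V] [Nonempty V] {n N : ℕ} (hN : 0 < N)
    (hn : ¬ G.HasCompleteMinor n) (hg : ((16 * (2 ^ n * N) + 3 : ℕ) : ℕ∞) ≤ G.egirth)
    (hdeg : ∀ v a, ∃ b, G.Adj v b ∧ b ≠ a) :
    ∃ v : ℕ → V, (∀ i, G.Adj (v i) (v (i + 1))) ∧ Set.InjOn v (Set.Iic N) ∧
      ∀ i < N, 0 < i → ∀ b, G.Adj (v i) b → b = v (i - 1) ∨ b = v (i + 1) := by
  classical
  have := Fintype.ofFinite V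
  by_contra! hcon
  refine hn ?_
  obtain ⟨Y, f, par, hfY, hYf, hpar, hwalk, hball⟩ := exists_ball_partition G (2 * (2 ^ n * N))
  set r := 2 * (2 ^ n * N) with hr
  let F : V → Y := fun x => ⟨f x, hfY x⟩
  have hF : ∀ y : Y, F y = y := fun y => Subtype.ext (hYf y y.2)
  have hFeq : ∀ x y, F x = F y ↔ f x = f y := fun x y => Subtype.ext_iff
  have hne : Nonempty Y := ‹Nonempty V›.map F
  refine HasCompleteMinor.of_contract (f := F) (fun y => ⟨y, hF y⟩) ?_
    (hasCompleteMinor_of_card_edgeFinset n (G.contract F) ?_)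
  · rintro y D hD ⟨d, hd⟩ hcl x hx
    have hroot : ∀ x ∈ F ⁻¹' {y}, x ∈ D ↔ (y : V) ∈ D := by
      intro x hx
      obtain ⟨w, -, he⟩ := hwalk x
      have hxy : f x = y := congrArg Subtype.val (Set.mem_singleton_iff.1 hx)
      rw [← hxy]
      refine mem_iff_mem_of_walk w fun a b hab ha => ?_
      have hFa : F a = y := hD ha
      obtain ⟨z, hz, hzab⟩ := he _ hab
      obtain ⟨hadj, hfz⟩ := hpar z hz
      rcases Sym2.eq_iff.1 hzab with ⟨rfl, rfl⟩ | ⟨rfl, rfl⟩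
      · exact hcl _ ha _ (((hFeq _ _).2 hfz).trans hFa) hadj
      · exact hcl _ ha _ (((hFeq _ _).2 hfz.symm).trans hFa) hadj.symm
    exact (hroot x hx).2 ((hroot d (hD hd)).1 hd)
  · have hB := card_edgeFinset_le_contract (G := G) F
      ((Finset.univ.filter (· ∉ Y)).image fun x => s(x, par x)) (by
        have hconn : ∀ x y, f x = f y → ∃ w : G.Walk x y, w.length ≤ 4 * r ∧
            ∀ e ∈ w.edges, ∃ z ∉ Y, e = s(z, par z) := by
          intro x y h
          have hwx := hwalk x
          rw [h] at hwx
          obtain ⟨w, hl, he⟩ := hwx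
          obtain ⟨w', hl', he'⟩ := hwalk y
          refine ⟨w.append w'.reverse, ?_, fun e hmem => ?_⟩
          · rw [Walk.length_append, Walk.length_reverse]; omega
          · rw [Walk.edges_append, List.mem_append, Walk.edges_reverse, List.mem_reverse] at hmem
            exact hmem.elim (he e) (he' e)
        have hmem : ∀ x y, s(x, y) ∉ (Finset.univ.filter (· ∉ Y)).image (fun x => s(x, par x)) →
            ¬ ∃ z ∉ Y, s(x, y) = s(z, par z) := by
          rintro x y hB ⟨z, hz, hzeq⟩
          exact hB (Finset.mem_image.2 ⟨z, by simpa using hz, hzeq.symm⟩)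
        have hfst : ∀ x y, G.Adj x y → (¬ ∃ z ∉ Y, s(x, y) = s(z, par z)) → f x ≠ f y := by
          intro x y hxy hP h
          obtain ⟨w, hl, he⟩ := hconn y x h.symm
          have := le_length_add_one_of_le_egirth hg hxy w fun h => hP (he _ h)
          omega
        intro x y hxy hxyB
        have hP := hmem x y hxyB
        refine ⟨fun h => hfst x y hxy hP ((hFeq _ _).1 h), fun x' y' hxy' _ hx hy => ?_⟩
        rw [hFeq] at hx hy
        by_contra hne'
        obtain ⟨w, hl, he⟩ := hconn y y' hy
        obtain ⟨w', hl', he'⟩ := hconn x' x hx.symm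
        have := le_length_add_one_of_le_egirth hg hxy (w.append (Walk.cons hxy'.symm w'))
          fun h => by
            rw [Walk.edges_append, List.mem_append, Walk.edges_cons, List.mem_cons] at h
            rcases h with h | h | h
            · exact hP (he _ h)
            · rcases Sym2.eq_iff.1 h with ⟨rfl, rfl⟩ | h
              · exact hfst _ _ hxy hP hy.symm
              · exact hne' h
            · exact hP (he' _ h)
        rw [Walk.length_append, Walk.length_cons] at this
        omega)
    have h1 : ((Finset.univ.filter (· ∉ Y)).image fun x => s(x, par x)).card + Fintype.card Y
        ≤ Fintype.card V := by
      refine (Nat.add_le_add_right Finset.card_image_le _).trans ?_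
      have : Fintype.card Y = (Finset.univ.filter (· ∈ Y)).card := Fintype.card_subtype _
      rw [this, add_comm, Finset.card_filter_add_card_filter_not, Finset.card_univ]
    have h2 : ∀ y : Y, 2 * 2 ^ n ≤ (Finset.univ.filter fun x => F x = y ∧ 3 ≤ G.degree x).card := by
      intro y
      obtain ⟨v, hv0, hv, hv'⟩ := exists_nonbacktracking_seq hdeg (y : V)
      have hinj : ∀ i j, i ≤ r → j ≤ r → v i = v j → i = j := by
        intro i j hi hj hij
        rcases lt_trichotomy i j with hlt | h | hlt
        · have := le_of_nonbacktracking_of_eq hg hv hv' (j - i) i (by omega)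
            (by rwa [Nat.add_sub_cancel' hlt.le])
          omega
        · exact h
        · have := le_of_nonbacktracking_of_eq hg hv hv' (i - j) j (by omega)
            (by rw [Nat.add_sub_cancel' hlt.le, hij])
          omega
      have hblock : ∀ a, a < 2 * 2 ^ n → a * N + N ≤ r := by
        intro a ha
        have := Nat.mul_le_mul_right N ha
        rw [Nat.succ_mul] at this
        rw [hr, ← mul_assoc]
        exact this
      have hbr : ∀ a, ∃ i, a < 2 * 2 ^ n → 0 < i ∧ i < N ∧ 3 ≤ G.degree (v (a * N + i)) := by
        intro a
        by_cases ha : a < 2 * 2 ^ n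
        swap
        · exact ⟨0, fun h => absurd h ha⟩
        have haN := hblock a ha
        obtain ⟨i, hiN, hi0, b, hb, hb1, hb2⟩ := hcon (fun i => v (a * N + i))
          (fun i => hv _) (fun i hi j hj hij => by
            have hi' : i ≤ N := hi
            have hj' : j ≤ N := hj
            have := hinj _ _ (by omega) (by omega) hij
            omega)
        refine ⟨i, fun _ => ⟨hi0, hiN, ?_⟩⟩
        obtain ⟨i, rfl⟩ : ∃ k, i = k + 1 := ⟨i - 1, by omega⟩
        have hsub : ({v (a * N + i), v (a * N + (i + 1 + 1)), b} : Finset V)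
            ⊆ G.neighborFinset (v (a * N + (i + 1))) := by
          intro x hx
          simp only [Finset.mem_insert, Finset.mem_singleton] at hx
          rw [mem_neighborFinset]
          rcases hx with rfl | rfl | rfl
          · exact (hv _).symm
          · exact hv _
          · exact hb
        have hcard := Finset.card_le_card hsub
        have hthree : ({v (a * N + i), v (a * N + (i + 1 + 1)), b} : Finset V).card = 3 :=
          Finset.card_eq_three.2 ⟨_, _, _, (hv' (a * N + i)).symm, hb1.symm, hb2.symm, rfl⟩
        rwa [hthree, card_neighborFinset_eq_degree] at hcard
      choose i hi using hbr
      have hcard := Finset.card_le_card_of_injOn (s := Finset.range (2 * 2 ^ n))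
        (t := Finset.univ.filter fun x => F x = y ∧ 3 ≤ G.degree x)
        (fun a => v (a * N + i a)) (by
          intro a ha
          obtain ⟨hi0, hiN, hi3⟩ := hi a (by simpa using ha)
          have haN := hblock a (by simpa using ha)
          simp only [Finset.coe_filter, Finset.mem_univ, true_and, Set.mem_ofPred_eq]
          refine ⟨Subtype.ext ?_, hi3⟩
          have hw := exists_walk_of_seq hv 0 (a * N + i a)
          rw [hv0, Nat.zero_add] at hw
          obtain ⟨w, hw, -⟩ := hw
          exact hball y y.2 _ w (by omega)) (by
          intro a ha b hb hab
          obtain ⟨hi0, hiN, -⟩ := hi a (by simpa using ha)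
          obtain ⟨hj0, hjN, -⟩ := hi b (by simpa using hb)
          have haN := hblock a (by simpa using ha)
          have hbN := hblock b (by simpa using hb)
          have h := congrArg (· / N) (hinj _ _ (by omega) (by omega) hab)
          simpa [Nat.add_div_of_dvd_right, Nat.div_eq_of_lt, hN, hiN, hjN,
            Nat.mul_div_cancel] using h)
      rwa [Finset.card_range] at hcard
    have h3 : Fintype.card Y * (2 * 2 ^ n) ≤ (Finset.univ.filter fun x => 3 ≤ G.degree x).card := by
      rw [Finset.card_eq_sum_card_fiberwise (f := F) (t := Finset.univ) fun _ _ => by simp]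
      rw [← Finset.card_univ, ← smul_eq_mul]
      refine Finset.card_nsmul_le_sum _ _ _ fun y _ => (h2 y).trans_eq ?_
      rw [Finset.filter_filter]
      simp only [and_comm]
    have h4 : 2 * Fintype.card V + (Finset.univ.filter fun x => 3 ≤ G.degree x).card
        ≤ 2 * G.edgeFinset.card := by
      rw [← G.sum_degrees_eq_twice_card_edges, Finset.card_filter, ← Finset.card_univ, mul_comm,
        ← smul_eq_mul, ← Finset.sum_const, ← Finset.sum_add_distrib]
      refine Finset.sum_le_sum fun x _ => ?_
      obtain ⟨b, hb, -⟩ := hdeg x x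
      obtain ⟨b', hb', hbb'⟩ := hdeg x b
      have := Finset.card_le_card (s := {b, b'}) (t := G.neighborFinset x) (by
        intro z hz
        simp only [Finset.mem_insert, Finset.mem_singleton] at hz
        rcases hz with rfl | rfl <;> simpa)
      rw [Finset.card_pair hbb'.symm, card_neighborFinset_eq_degree] at this
      split_ifs <;> omega
    nlinarith

end Ear

section Leveling

variable {V : Type u} {G : SimpleGraph V}

/-- A witness that `G` restricted to `S` becomes a forest after deleting a set `X` of vertices that
are far apart: `ℓ` gives the levels of the forest, `K` is a set of minimum degree at least two that
contains `X`, and each connected set that meets `X` twice meets all levels modulo `p + 1`. -/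
structure IsLeveling (G : SimpleGraph V) (p : ℕ) (S K X : Set V) (ℓ : V → ℕ) : Prop where
  subset_core : X ⊆ K
  core_subset : K ⊆ S
  core_degree : ∀ x ∈ K, ∀ a, ∃ b ∈ K, G.Adj x b ∧ b ≠ a
  step : ∀ u ∈ S \ X, ∀ v ∈ S \ X, G.Adj u v → ℓ v = ℓ u + 1 ∨ ℓ u = ℓ v + 1
  parent_unique : ∀ u ∈ S \ X, ∀ v ∈ S \ X, ∀ w ∈ S \ X, G.Adj u v → G.Adj u w →
    ℓ u = ℓ v + 1 → ℓ u = ℓ w + 1 → v = w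
  spread : ∀ T ⊆ S, G.SetConn T → ∀ x ∈ T ∩ X, ∀ y ∈ T ∩ X, x ≠ y →
    ∀ q, ∃ t ∈ T \ X, ℓ t ≡ q [MOD p + 1]

lemma SetConn.diff_singleton {T : Set V} (hT : G.SetConn T) {v a : V}
    (hv : ∀ b ∈ T, G.Adj v b → b = a) : G.SetConn (T \ {v}) := by
  rintro D hD hne hcl x ⟨hx, hxv⟩
  by_cases ha : v ∈ T ∧ a ∈ D
  · have := hT (insert v D)
      (Set.insert_subset ha.1 (hD.trans Set.sdiff_subset)) (Set.insert_nonempty _ _) (by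
        rintro y (rfl | hy) b hb hyb
        · exact .inr (hv b hb hyb ▸ ha.2)
        · by_cases hbv : b = v
          · exact .inl hbv
          · exact .inr (hcl y hy b ⟨hb, hbv⟩ hyb)) hx
    exact this.resolve_left hxv
  · refine hT D (hD.trans Set.sdiff_subset) hne (fun y hy b hb hyb => hcl y hy b ⟨hb, ?_⟩ hyb) hx
    rintro rfl
    exact ha ⟨hb, hv y (hD hy).1 hyb.symm ▸ hy⟩

lemma IsLeveling.insert_leaf {p : ℕ} {S K X : Set V} {ℓ : V → ℕ} {v a : V}
    (h : G.IsLeveling p (S \ {v}) K X ℓ) (hv : ∀ b ∈ S, G.Adj v b → b = a) :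
    ∃ ℓ', G.IsLeveling p S K X ℓ' := by
  classical
  have hvX : v ∉ X := fun hx => (h.core_subset (h.subset_core hx)).2 rfl
  have hS : ∀ x ∈ S \ X, x ≠ v → x ∈ (S \ {v}) \ X := fun x hx hxv => ⟨⟨hx.1, hxv⟩, hx.2⟩
  have hself : ∀ x, x ≠ v → Function.update ℓ v (ℓ a + 1) x = ℓ x := fun x hx =>
    Function.update_of_ne hx _ _
  have hnew : Function.update ℓ v (ℓ a + 1) v = ℓ a + 1 := Function.update_self _ _ _
  refine ⟨Function.update ℓ v (ℓ a + 1), h.subset_core, h.core_subset.trans Set.sdiff_subset,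
    h.core_degree, ?_, ?_, ?_⟩
  · intro u hu w hw huw
    by_cases huv : u = v
    · subst huv
      rw [hnew, hself w huw.ne', hv w hw.1 huw]
      exact .inr rfl
    · by_cases hwv : w = v
      · subst hwv
        rw [hnew, hself u huv, hv u hu.1 huw.symm]
        exact .inl rfl
      · rw [hself u huv, hself w hwv]
        exact h.step u (hS u hu huv) w (hS w hw hwv) huw
  · intro u hu x hx y hy hux huy hlx hly
    by_cases huv : u = v
    · subst huv
      rw [hv x hx.1 hux, hv y hy.1 huy]
    · rw [hself u huv] at hlx hly
      have hne : ∀ z, G.Adj u z → ℓ u = Function.update ℓ v (ℓ a + 1) z + 1 → z ≠ v := by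
        rintro z huz hlz rfl
        rw [hnew, ← hv u hu.1 huz.symm] at hlz
        omega
      have hxv := hne x hux hlx
      have hyv := hne y huy hly
      rw [hself x hxv] at hlx
      rw [hself y hyv] at hly
      exact h.parent_unique u (hS u hu huv) x (hS x hx hxv) y (hS y hy hyv) hux huy hlx hly
  · intro T hT hconn x hx y hy hxy q
    have hXv : ∀ z ∈ X, z ≠ v := fun z hz hzv => hvX (hzv ▸ hz)
    obtain ⟨t, ht, hq⟩ := h.spread (T \ {v}) (Set.sdiff_subset_sdiff_left hT)
      (hconn.diff_singleton fun b hb => hv b (hT hb)) x ⟨⟨hx.1, hXv x hx.2⟩, hx.2⟩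
      y ⟨⟨hy.1, hXv y hy.2⟩, hy.2⟩ hxy q
    exact ⟨t, ⟨ht.1.1, ht.2⟩, by rwa [hself t ht.1.2]⟩

lemma exists_le_add_modEq (p c q : ℕ) : ∃ j ≤ p, c + j ≡ q [MOD p + 1] := by
  refine ⟨(q + p * c) % (p + 1), Nat.lt_succ_iff.1 (Nat.mod_lt _ p.succ_pos), ?_⟩
  have h1 : c + (q + p * c) % (p + 1) ≡ c + (q + p * c) [MOD p + 1] :=
    (Nat.mod_modEq _ _).add_left c
  refine h1.trans ?_
  rw [show c + (q + p * c) = q + (p + 1) * c by ring]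
  simp [Nat.ModEq]

/-- A sequence with steps `±1` that never goes up and then down at once meets all residues. -/
lemma exists_modEq_of_no_peak {p : ℕ} {e : ℕ → ℕ}
    (hstep : ∀ i < 2 * p + 1, e (i + 1) = e i + 1 ∨ e i = e (i + 1) + 1)
    (hpeak : ∀ i < 2 * p, e (i + 1) = e i + 1 → e (i + 1) ≠ e (i + 2) + 1) (q : ℕ) :
    ∃ i ≤ 2 * p + 1, e i ≡ q [MOD p + 1] := by
  by_cases hup : ∃ i ≤ p, e (i + 1) = e i + 1
  · obtain ⟨i, hi, hiup⟩ := hup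
    have hrun : ∀ j ≤ p, e (i + j) = e i + j ∧ e (i + j + 1) = e (i + j) + 1 := by
      intro j
      induction j with
      | zero => exact fun _ => ⟨rfl, hiup⟩
      | succ j ih =>
        intro hj
        obtain ⟨h1, h2⟩ := ih (by omega)
        refine ⟨by rw [← add_assoc, h2, h1]; rfl, ?_⟩
        exact (hstep (i + (j + 1)) (by omega)).resolve_right (hpeak (i + j) (by omega) h2)
    obtain ⟨j, hj, hq⟩ := exists_le_add_modEq p (e i) q
    exact ⟨i + j, by omega, by rwa [(hrun j hj).1]⟩
  · push Not at hup
    have hrun : ∀ j ≤ p, e 0 = e j + j := by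
      intro j
      induction j with
      | zero => exact fun _ => rfl
      | succ j ih =>
        intro hj
        have h1 := ih (by omega)
        have h2 := (hstep j (by omega)).resolve_left (hup j (by omega))
        omega
    obtain ⟨j, hj, hq⟩ := exists_le_add_modEq p (e p) q
    have h1 := hrun p le_rfl
    have h2 := hrun (p - j) (by omega)
    exact ⟨p - j, by omega, by rwa [show e (p - j) = e p + j by omega]⟩

lemma IsLeveling.insert_ear {p : ℕ} {S K X : Set V} {ℓ : V → ℕ} {v : ℕ → V}
    (h : G.IsLeveling p (S \ {v (2 * p + 3)}) K X ℓ)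
    (hdeg : ∀ x ∈ S, ∀ a, ∃ b ∈ S, G.Adj x b ∧ b ≠ a)
    (hvS : ∀ i, v i ∈ S) (hv : ∀ i, G.Adj (v i) (v (i + 1)))
    (hinj : Set.InjOn v (Set.Iic (4 * p + 6)))
    (hear : ∀ i < 4 * p + 6, 0 < i → ∀ b ∈ S, G.Adj (v i) b → b = v (i - 1) ∨ b = v (i + 1)) :
    G.IsLeveling p S S (insert (v (2 * p + 3)) X) ℓ := by
  set m := v (2 * p + 3) with hm
  have hmK : m ∉ K := fun hx => (h.core_subset hx).2 rfl
  have hright : ∀ i ≤ 2 * p + 2, v (2 * p + 3 + i) ∉ K := by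
    intro i
    induction i with
    | zero => exact fun _ => hmK
    | succ i ih =>
      intro hi hK
      obtain ⟨b, hb, hadj, hne⟩ := h.core_degree _ hK (v (2 * p + 3 + (i + 1) + 1))
      have := (hear _ (by omega) (by omega) b (h.core_subset hb).1 hadj).resolve_right hne
      rw [this] at hb
      exact ih (by omega) hb
  have hleft : ∀ i ≤ 2 * p + 2, v (2 * p + 3 - i) ∉ K := by
    intro i
    induction i with
    | zero => exact fun _ => hmK
    | succ i ih =>
      intro hi hK
      obtain ⟨b, hb, hadj, hne⟩ := h.core_degree _ hK (v (2 * p + 3 - (i + 1) - 1))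
      have := (hear _ (by omega) (by omega) b (h.core_subset hb).1 hadj).resolve_left hne
      rw [this, show 2 * p + 3 - (i + 1) + 1 = 2 * p + 3 - i by omega] at hb
      exact ih (by omega) hb
  have hvK : ∀ i, 0 < i → i < 4 * p + 6 → v i ∉ K := by
    intro i hi0 hi
    rcases le_total i (2 * p + 3) with hle | hle
    · have := hleft (2 * p + 3 - i) (by omega)
      rwa [Nat.sub_sub_self hle] at this
    · have := hright (i - (2 * p + 3)) (by omega)
      rwa [Nat.add_sub_cancel' hle] at this
  have hdiff : S \ insert m X = (S \ {m}) \ X := by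
    rw [Set.sdiff_sdiff, Set.singleton_union]
  refine ⟨Set.insert_subset (hvS _) ((h.subset_core.trans h.core_subset).trans Set.sdiff_subset),
    subset_rfl, hdeg, by rw [hdiff]; exact h.step, by rw [hdiff]; exact h.parent_unique, ?_⟩
  have hmid : ∀ T ⊆ S, G.SetConn T → m ∈ T → ∀ y ∈ T ∩ X, ∀ q,
      ∃ t ∈ T \ insert m X, ℓ t ≡ q [MOD p + 1] := by
    intro T hT hconn hmT y hy q
    have hwindow : ∀ s, (∀ i ≤ 2 * p + 1, v (s + i) ∈ T ∧ s + i ≠ 2 * p + 3 ∧ 0 < s + i ∧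
        s + i < 4 * p + 6) → ∃ t ∈ T \ insert m X, ℓ t ≡ q [MOD p + 1] := by
      intro s hs
      have hmem : ∀ i ≤ 2 * p + 1, v (s + i) ∈ T \ insert m X := by
        intro i hi
        obtain ⟨h1, h2, h3, h4⟩ := hs i hi
        refine ⟨h1, ?_⟩
        rintro (h | hX)
        · exact h2 (hinj (Set.mem_Iic.2 h4.le) (Set.mem_Iic.2 (by omega)) h)
        · exact hvK _ h3 h4 (h.subset_core hX)
      have hmem' : ∀ i ≤ 2 * p + 1, v (s + i) ∈ (S \ {m}) \ X := fun i hi =>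
        hdiff ▸ ⟨hT (hmem i hi).1, (hmem i hi).2⟩
      obtain ⟨i, hi, hq⟩ := exists_modEq_of_no_peak (p := p) (e := fun i => ℓ (v (s + i)))
        (fun i hi => h.step _ (hmem' i (by omega)) _ (hmem' (i + 1) (by omega)) (hv _))
        (fun i hi hup hdown => by
          have := h.parent_unique _ (hmem' (i + 1) (by omega)) _ (hmem' i (by omega))
            _ (hmem' (i + 2) (by omega)) (hv _).symm (hv _) hup hdown
          have := hinj (Set.mem_Iic.2 (hs i (by omega)).2.2.2.le)
            (Set.mem_Iic.2 (hs (i + 2) (by omega)).2.2.2.le) this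
          omega) q
      exact ⟨_, hmem i hi, hq⟩
    by_cases hl : ∀ i, 0 < i → i < 2 * p + 3 → v i ∈ T
    · exact hwindow 1 fun i hi => ⟨hl _ (by omega) (by omega), by omega, by omega, by omega⟩
    by_cases hr : ∀ i, 2 * p + 3 < i → i < 4 * p + 6 → v i ∈ T
    · exact hwindow (2 * p + 4) fun i hi =>
        ⟨hr _ (by omega) (by omega), by omega, by omega, by omega⟩
    push Not at hl hr
    obtain ⟨i, hi0, hi, hiT⟩ := hl
    obtain ⟨j, hj, hjN, hjT⟩ := hr
    have key := hconn {x ∈ T | ∃ k, i < k ∧ k < j ∧ x = v k} (Set.sep_subset _ _)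
      ⟨m, hmT, 2 * p + 3, hi, hj, rfl⟩ (by
        rintro _ ⟨-, k, hik, hkj, rfl⟩ b hb hadj
        rcases hear k (by omega) (by omega) b (hT hb) hadj with rfl | rfl
        · refine ⟨hb, k - 1, ?_, by omega, rfl⟩
          by_contra hk
          exact hiT (by rwa [show i = k - 1 by omega])
        · refine ⟨hb, k + 1, by omega, ?_, rfl⟩
          by_contra hk
          exact hjT (by rwa [show j = k + 1 by omega])) hy.1
    obtain ⟨-, k, hik, hkj, rfl⟩ := key
    exact absurd (h.subset_core hy.2) (hvK k (by omega) (by omega))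
  rintro T hT hconn x ⟨hxT, hx⟩ y ⟨hyT, hy⟩ hxy q
  by_cases hmT : m ∈ T
  · rcases hx with rfl | hx
    · exact hmid T hT hconn hmT y ⟨hyT, hy.resolve_left hxy.symm⟩ q
    · exact hmid T hT hconn hmT x ⟨hxT, hx⟩ q
  · have hne : ∀ z ∈ T, z ≠ m := fun z hz hzm => hmT (hzm ▸ hz)
    obtain ⟨t, ht, hq⟩ := h.spread T (fun z hz => ⟨hT hz, hne z hz⟩) hconn
      x ⟨hxT, hx.resolve_left (hne x hxT)⟩ y ⟨hyT, hy.resolve_left (hne y hyT)⟩ hxy q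
    exact ⟨t, ⟨ht.1, fun hins => hins.elim (hne t ht.1) ht.2⟩, hq⟩

lemma le_egirth_induce {g : ℕ∞} (hg : g ≤ G.egirth) (S : Set V) : g ≤ (G.induce S).egirth := by
  rw [le_egirth] at hg ⊢
  intro a w hw
  have := hg _ _ (hw.map (f := (Embedding.induce (G := G) S).toHom) Subtype.val_injective)
  rwa [Walk.length_map] at this

/-- Graphs of large girth without a large complete minor have levelings. -/
theorem exists_isLeveling [Finite V] {n p : ℕ} (hn : ¬ G.HasCompleteMinor n)
    (hg : ((16 * (2 ^ n * (4 * p + 6)) + 3 : ℕ) : ℕ∞) ≤ G.egirth) (S : Set V) :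
    ∃ K X ℓ, G.IsLeveling p S K X ℓ := by
  induction S using WellFoundedLT.induction with
  | _ S ih
  have hlt : ∀ x ∈ S, S \ {x} < S := fun x hx =>
    (Set.ssubset_iff_of_subset Set.sdiff_subset).2 ⟨x, hx, by simp⟩
  by_cases hdeg : ∀ x ∈ S, ∀ a, ∃ b ∈ S, G.Adj x b ∧ b ≠ a
  · rcases S.eq_empty_or_nonempty with rfl | hS
    · exact ⟨∅, ∅, 0, by simp, by simp, by simp, by simp, by simp, by simp⟩
    · have := hS.to_subtype
      obtain ⟨v, hv, hinj, hear⟩ := exists_long_ear (G := G.induce S) (n := n) (N := 4 * p + 6)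
        (by omega) (fun h => hn (h.map (Embedding.induce S))) (le_egirth_induce hg S)
        (fun x a => by
          obtain ⟨b, hb, hadj, hne⟩ := hdeg x x.2 a
          exact ⟨⟨b, hb⟩, hadj, fun h => hne (congrArg Subtype.val h)⟩)
      obtain ⟨K, X, ℓ, h⟩ := ih _ (hlt (v (2 * p + 3)) (v _).2)
      refine ⟨_, _, _, h.insert_ear (v := fun i => ((v i : S) : V)) hdeg (fun i => (v i).2)
        (fun i => hv i) (Subtype.val_injective.comp_injOn hinj) fun i hi hi0 b hb hadj => ?_⟩
      rcases hear i hi hi0 ⟨b, hb⟩ hadj with h | h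
      · exact .inl (congrArg Subtype.val h)
      · exact .inr (congrArg Subtype.val h)
  · push Not at hdeg
    obtain ⟨x, hx, a, hxa⟩ := hdeg
    obtain ⟨K, X, ℓ, h⟩ := ih _ (hlt x hx)
    obtain ⟨ℓ', h'⟩ := h.insert_leaf hxa
    exact ⟨K, X, ℓ', h'⟩

end Leveling

section Coloring

variable {V : Type u} {G : SimpleGraph V}

/-- A leveling of all of `G` yields a coloring with `p + 2` colors in which every connected set
with at most `p` colors has a color that appears exactly once. -/
lemma IsLeveling.exists_coloring [Finite V] {p : ℕ} {K X : Set V} {ℓ : V → ℕ}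
    (h : G.IsLeveling p Set.univ K X ℓ) : ∃ c : V → Fin (p + 2), ∀ T : Set V, T.Nonempty →
      G.SetConn T → ∀ s : Finset (Fin (p + 2)), (∀ x ∈ T, c x ∈ s) → s.card ≤ p →
        ∃ t ∈ T, ∀ x ∈ T, c x = c t → x = t := by
  classical
  let r : V → Fin (p + 1) := fun x => ⟨ℓ x % (p + 1), Nat.mod_lt _ p.succ_pos⟩
  refine ⟨fun x => if x ∈ X then Fin.last _ else (r x).castSucc, ?_⟩
  intro T hTne hT s hs hcard
  have hall : ¬ ∀ q, ∃ t ∈ T \ X, ℓ t ≡ q [MOD p + 1] := by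
    intro hq
    have : (Finset.univ.map Fin.castSuccEmb : Finset (Fin (p + 2))) ⊆ s := by
      intro k hk
      obtain ⟨q, -, rfl⟩ := Finset.mem_map.1 hk
      obtain ⟨t, ht, htq⟩ := hq q
      have h1 := hs t ht.1
      simp only [if_neg ht.2] at h1
      have h2 : r t = q := Fin.ext (by
        rw [← Nat.mod_eq_of_lt q.2]; exact htq)
      rwa [h2] at h1
    have := Finset.card_le_card this
    rw [Finset.card_map, Finset.card_univ, Fintype.card_fin] at this
    omega
  by_cases hX : ∃ x ∈ T, x ∈ X
  · obtain ⟨x, hxT, hxX⟩ := hX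
    refine ⟨x, hxT, fun y hyT hxy => ?_⟩
    by_contra hne
    have hyX : y ∈ X := by
      by_contra hyX
      simp only [if_pos hxX, if_neg hyX] at hxy
      exact (Fin.castSucc_lt_last _).ne hxy
    exact hall (h.spread T (Set.subset_univ _) hT y ⟨hyT, hyX⟩ x ⟨hxT, hxX⟩ hne)
  push Not at hX
  have hmem : ∀ x ∈ T, x ∈ Set.univ \ X := fun x hx => ⟨trivial, hX x hx⟩
  obtain ⟨t, ht, hmin⟩ := Set.exists_min_image T ℓ T.toFinite hTne
  have hmin' : ∀ x ∈ T, x = t ∨ ℓ t < ℓ x := by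
    have key := hT {x ∈ T | Relation.ReflTransGen
        (fun a b => a ∈ T ∧ G.Adj a b ∧ ℓ b = ℓ a + 1) t x} (Set.sep_subset _ _)
      ⟨t, ht, .refl⟩ (by
        rintro a ⟨ha, hta⟩ b hb hab
        refine ⟨hb, ?_⟩
        rcases h.step a (hmem a ha) b (hmem b hb) hab with hup | hdown
        · exact hta.tail ⟨ha, hab, hup⟩
        · rcases Relation.ReflTransGen.cases_tail hta with rfl | ⟨a', hta', ha', haa', hl⟩
          · have := hmin b hb
            omega
          · rwa [h.parent_unique a (hmem a ha) b (hmem b hb) a' (hmem a' ha') hab haa'.symm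
              hdown hl])
    intro x hx
    have hle : ∀ y, Relation.ReflTransGen
        (fun a b => a ∈ T ∧ G.Adj a b ∧ ℓ b = ℓ a + 1) t y → ℓ t ≤ ℓ y := by
      intro y hy
      induction hy with
      | refl => exact le_rfl
      | tail _ hab ih => have := hab.2.2; omega
    rcases Relation.ReflTransGen.cases_tail (key hx).2 with h | ⟨a, hta, -, -, hl⟩
    · exact .inl h
    · have := hle a hta
      exact .inr (by omega)
  have hlt : ∀ x ∈ T, ℓ x < ℓ t + (p + 1) := by
    intro x hx
    by_contra! hge
    refine hall fun q => ?_
    obtain ⟨j, hj, hjq⟩ := exists_le_add_modEq p (ℓ t) q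
    by_contra! hcon
    have hlev : ∀ y ∈ T, ℓ y ≠ ℓ t + j := fun y hy hyj =>
      hcon y ⟨hy, hX y hy⟩ (by rwa [hyj])
    have hj0 : 0 < j := Nat.pos_of_ne_zero fun h0 => hlev t ht (by rw [h0]; rfl)
    have key := hT {y ∈ T | ℓ y < ℓ t + j} (Set.sep_subset _ _) ⟨t, ht, by omega⟩ (by
      rintro a ⟨ha, hlt⟩ b hb hab
      have := hlev b hb
      refine ⟨hb, ?_⟩
      rcases h.step a (hmem a ha) b (hmem b hb) hab with h | h <;> omega) hx
    have := key.2
    omega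
  refine ⟨t, ht, fun x hx hxt => ?_⟩
  simp only [if_neg (hX x hx), if_neg (hX t ht), Fin.castSucc_inj, r, Fin.mk.injEq] at hxt
  refine (hmin' x hx).resolve_right fun hlt' => ?_
  have h1 := hlt x hx
  have h2 := (Nat.modEq_iff_dvd' hlt'.le).1 hxt.symm
  have h3 := Nat.le_of_dvd (by omega) h2
  omega

end Coloring

section TreeOrder

variable {V : Type u} {G : SimpleGraph V}

/-- `G` restricted to `W` embeds into the closure of a rooted forest of height at most `k`, given
by its strict ancestor relation. -/
def HasTreeOrder (G : SimpleGraph V) (W : Set V) (k : ℕ) : Prop :=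
  ∃ lt : V → V → Prop, (∀ u v, lt u v → u ∈ W ∧ v ∈ W) ∧ (∀ u v w, lt u v → lt v w → lt u w) ∧
    (∀ u, ¬ lt u u) ∧ (∀ x y z, lt x z → lt y z → lt x y ∨ lt y x ∨ x = y) ∧
    (∀ u ∈ W, ∀ v ∈ W, G.Adj u v → lt u v ∨ lt v u) ∧
    (∀ s : Finset V, (∀ x ∈ s, x ∈ W) → (∀ x ∈ s, ∀ y ∈ s, x = y ∨ lt x y ∨ lt y x) → s.card ≤ k)

lemma HasTreeOrder.treeDepth_induce_le {W : Set V} {_ : Fintype W} {k : ℕ}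
    (h : G.HasTreeOrder W k) : (G.induce W).treeDepth ≤ k := by
  obtain ⟨lt, -, htrans, hirr, hchain, hadj, hcard⟩ := h
  refine Nat.sInf_le ⟨fun x y => lt x y, fun _ _ _ => htrans _ _ _, fun _ => hirr _,
    fun x y z hx hy => ?_, fun u v huv => hadj u u.2 v v.2 huv, fun s hs => ?_⟩
  · simpa only [Subtype.ext_iff] using hchain x y z hx hy
  · rw [← Finset.card_map (Function.Embedding.subtype _)]
    refine hcard (s.map (Function.Embedding.subtype _)) (fun x hx => ?_) fun x hx y hy => ?_
    · obtain ⟨x, -, rfl⟩ := Finset.mem_map.1 hx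
      exact x.2
    · obtain ⟨x', hx', rfl⟩ := Finset.mem_map.1 hx
      obtain ⟨y', hy', rfl⟩ := Finset.mem_map.1 hy
      exact (hs x' hx' y' hy').imp (congrArg Subtype.val) id

lemma HasTreeOrder.insert_root {W : Set V} {k : ℕ} {r : V} (hr : r ∈ W)
    (h : G.HasTreeOrder (W \ {r}) k) : G.HasTreeOrder W (k + 1) := by
  classical
  obtain ⟨lt, hsub, htrans, hirr, hchain, hadj, hcard⟩ := h
  have hrl : ∀ u, ¬ lt r u := fun u h => (hsub _ _ h).1.2 rfl
  have hrr : ∀ u, ¬ lt u r := fun u h => (hsub _ _ h).2.2 rfl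
  refine ⟨fun u v => (u = r ∧ v ∈ W ∧ v ≠ r) ∨ lt u v, ?_, ?_, ?_, ?_, ?_, ?_⟩
  · rintro u v (⟨rfl, hv, -⟩ | h)
    · exact ⟨hr, hv⟩
    · exact ⟨(hsub _ _ h).1.1, (hsub _ _ h).2.1⟩
  · rintro u v w (⟨rfl, hv, hvr⟩ | h) (⟨rfl, hw, hwr⟩ | h')
    · exact absurd rfl hvr
    · exact .inl ⟨rfl, (hsub _ _ h').2.1, (hsub _ _ h').2.2⟩
    · exact absurd h (hrr u)
    · exact .inr (htrans _ _ _ h h')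
  · rintro u (⟨rfl, -, h⟩ | h)
    · exact h rfl
    · exact hirr u h
  · rintro x y z (⟨rfl, hz, hzr⟩ | h) (⟨rfl, hz', hzr'⟩ | h')
    · exact .inr (.inr rfl)
    · exact .inl (.inl ⟨rfl, (hsub _ _ h').1.1, (hsub _ _ h').1.2⟩)
    · exact .inr (.inl (.inl ⟨rfl, (hsub _ _ h).1.1, (hsub _ _ h).1.2⟩))
    · rcases hchain x y z h h' with h | h | h
      · exact .inl (.inr h)
      · exact .inr (.inl (.inr h))
      · exact .inr (.inr h)
  · intro u hu v hv huv
    by_cases hur : u = r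
    · exact .inl (.inl ⟨hur, hv, fun h => huv.ne (hur.trans h.symm)⟩)
    by_cases hvr : v = r
    · exact .inr (.inl ⟨hvr, hu, hur⟩)
    · exact (hadj u ⟨hu, hur⟩ v ⟨hv, hvr⟩ huv).imp .inr .inr
  · intro s hsW hs
    have h1 : (s.erase r).card ≤ k := by
      refine hcard _ (fun x hx => ?_) fun x hx y hy => ?_
      · rw [Finset.mem_erase] at hx
        exact ⟨hsW x hx.2, hx.1⟩
      · rw [Finset.mem_erase] at hx hy
        have := hs x hx.2 y hy.2
        simpa [hx.1, hy.1] using this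
    have := Finset.pred_card_le_card_erase (s := s) (a := r)
    omega

lemma HasTreeOrder.of_forall_setConn {W : Set V} {k : ℕ}
    (h : ∀ T ⊆ W, T.Nonempty → G.SetConn T → G.HasTreeOrder T k) : G.HasTreeOrder W k := by
  classical
  let R : V → V → Prop := Relation.ReflTransGen fun a b => G.Adj a b ∧ a ∈ W ∧ b ∈ W
  let C : V → Set V := fun u => {v | R u v}
  have hsymm : ∀ u v, R u v → R v u := fun u v huv => by
    have : Std.Symm fun a b => G.Adj a b ∧ a ∈ W ∧ b ∈ W :=
      ⟨fun a b hab => ⟨hab.1.symm, hab.2.2, hab.2.1⟩⟩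
    exact Relation.ReflTransGen.stdSymm.symm _ _ huv
  have hCeq : ∀ u, ∀ v ∈ C u, C v = C u := fun u v huv => by
    ext w
    exact ⟨fun hw => Relation.ReflTransGen.trans huv hw,
      fun hw => Relation.ReflTransGen.trans (hsymm _ _ huv) hw⟩
  have hself : ∀ u, u ∈ C u := fun u => .refl
  have hCW : ∀ u ∈ W, C u ⊆ W := by
    intro u hu v huv
    induction huv with
    | refl => exact hu
    | tail _ hab _ => exact hab.2.2
  have hCconn : ∀ u, G.SetConn (C u) := by
    rintro u D hD ⟨d, hd⟩ hcl v hv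
    rw [← hCeq u d (hD hd)] at hv
    induction hv with
    | refl => exact hd
    | tail _ hab ih =>
      exact hcl _ ih _ (Relation.ReflTransGen.tail (hD ih) hab) hab.1
  have hC : ∀ u : W, G.HasTreeOrder (C u) k := fun u =>
    h _ (hCW u u.2) ⟨u, hself u⟩ (hCconn u)
  have hF : ∀ T : Set V, ∃ lt : V → V → Prop, (∃ u : W, T = C u) →
      (∀ u v, lt u v → u ∈ T ∧ v ∈ T) ∧ (∀ u v w, lt u v → lt v w → lt u w) ∧
      (∀ u, ¬ lt u u) ∧ (∀ x y z, lt x z → lt y z → lt x y ∨ lt y x ∨ x = y) ∧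
      (∀ u ∈ T, ∀ v ∈ T, G.Adj u v → lt u v ∨ lt v u) ∧
      (∀ s : Finset V, (∀ x ∈ s, x ∈ T) → (∀ x ∈ s, ∀ y ∈ s, x = y ∨ lt x y ∨ lt y x) →
        s.card ≤ k) := by
    intro T
    by_cases hT : ∃ u : W, T = C u
    · obtain ⟨u, rfl⟩ := hT
      obtain ⟨lt, hlt⟩ := hC u
      exact ⟨lt, fun _ => hlt⟩
    · exact ⟨fun _ _ => False, fun h => absurd h hT⟩
  choose F hF using hF
  have hF' : ∀ u ∈ W, _ := fun u hu => hF (C u) ⟨⟨u, hu⟩, rfl⟩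
  have hlt : ∀ u v, u ∈ W → F (C u) u v → C v = C u := fun u v hu huv =>
    hCeq u v ((hF' u hu).1 u v huv).2
  have hlt' : ∀ u v, v ∈ W → F (C v) u v → C u = C v := fun u v hv huv =>
    hCeq v u ((hF' v hv).1 u v huv).1
  refine ⟨fun u v => u ∈ W ∧ F (C u) u v, ?_, ?_, ?_, ?_, ?_, ?_⟩
  · rintro u v ⟨hu, huv⟩
    exact ⟨hu, hCW u hu ((hF' u hu).1 u v huv).2⟩
  · rintro u v w ⟨hu, huv⟩ ⟨hv, hvw⟩
    rw [hlt u v hu huv] at hvw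
    exact ⟨hu, (hF' u hu).2.1 u v w huv hvw⟩
  · rintro u ⟨hu, huu⟩
    exact (hF' u hu).2.2.1 u huu
  · rintro x y z ⟨hx, hxz⟩ ⟨hy, hyz⟩
    have hxy : C y = C x := (hlt y z hy hyz).symm.trans (hlt x z hx hxz)
    simp only [hxy] at hyz ⊢
    rcases (hF' x hx).2.2.2.1 x y z hxz hyz with h | h | h
    · exact .inl ⟨hx, h⟩
    · exact .inr (.inl ⟨hy, h⟩)
    · exact .inr (.inr h)
  · intro u hu v hv huv
    have hvC : v ∈ C u := .single ⟨huv, hu, hv⟩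
    simp only [hCeq u v hvC]
    exact ((hF' u hu).2.2.2.2.1 u (hself u) v hvC huv).imp (fun h => ⟨hu, h⟩) fun h => ⟨hv, h⟩
  · intro s hsW hs
    rcases s.eq_empty_or_nonempty with rfl | ⟨u, hu⟩
    · simp
    have huW := hsW u hu
    have hCs : ∀ x ∈ s, C x = C u := by
      intro x hx
      rcases hs x hx u hu with rfl | ⟨h1, h2⟩ | ⟨h1, h2⟩
      · rfl
      · exact (hlt x u h1 h2).symm
      · exact hlt u x h1 h2
    refine (hF' u huW).2.2.2.2.2 s (fun x hx => hCs x hx ▸ hself x) fun x hx y hy => ?_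
    rcases hs x hx y hy with h | ⟨-, h⟩ | ⟨-, h⟩
    · exact .inl h
    · exact .inr (.inl (hCs x hx ▸ h))
    · exact .inr (.inr (hCs y hy ▸ h))

lemma hasTreeOrder_of_coloring {α : Type*} {c : V → α} {p : ℕ}
    (hc : ∀ T : Set V, T.Nonempty → G.SetConn T → ∀ s : Finset α, (∀ x ∈ T, c x ∈ s) →
      s.card ≤ p → ∃ t ∈ T, ∀ x ∈ T, c x = c t → x = t) (k : ℕ) (hk : k ≤ p) :
    ∀ s : Finset α, s.card = k → ∀ W : Set V, (∀ x ∈ W, c x ∈ s) → G.HasTreeOrder W k := by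
  classical
  induction k with
  | zero =>
    intro s hs W hW
    rw [Finset.card_eq_zero] at hs
    subst hs
    have hW' : ∀ x, x ∉ W := fun x hx => by simpa using hW x hx
    refine ⟨fun _ _ => False, by simp, by simp, by simp, by simp, fun u hu => absurd hu (hW' u),
      fun s hs _ => ?_⟩
    rw [Finset.eq_empty_of_forall_notMem fun x hx => hW' x (hs x hx), Finset.card_empty]
  | succ k ih =>
    intro s hs W hW
    refine HasTreeOrder.of_forall_setConn fun T hTW hTne hT => ?_
    obtain ⟨t, ht, huniq⟩ := hc T hTne hT s (fun x hx => hW x (hTW hx)) (hs.trans_le hk)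
    refine HasTreeOrder.insert_root ht (ih (by omega) (s.erase (c t)) ?_ _ fun x hx => ?_)
    · rw [Finset.card_erase_of_mem (hW t (hTW ht)), hs, Nat.add_sub_cancel]
    · exact Finset.mem_erase.2 ⟨fun h => hx.2 (huniq x hx.1 h), hW x (hTW hx.1)⟩

end TreeOrder

end SimpleGraph

theorem chiP_of_large_girth_minor_closed
    (C : GraphClass) (hclosed : C.MinorClosed)
    (hproper : ∃ (n : ℕ) (H : SimpleGraph (Fin n)), (⟨n, H⟩ : (n : ℕ) × SimpleGraph (Fin n)) ∉ C) :
    ∀ p : ℕ, 0 < p → ∃ g : ℕ, ∀ G ∈ C, (g : ℕ∞) ≤ (Sigma.snd G).egirth →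
      (Sigma.snd G).chiP p ≤ p + 2 := by
  intro p _
  obtain ⟨n, H, hH⟩ := hproper
  refine ⟨16 * (2 ^ n * (4 * p + 6)) + 3, fun G hG hg => ?_⟩
  have hn : ¬ (Sigma.snd G).HasCompleteMinor n := fun h => hH (hclosed G hG n H (h.isMinor H))
  obtain ⟨K, X, ℓ, hℓ⟩ := exists_isLeveling hn hg Set.univ
  obtain ⟨c, hc⟩ := hℓ.exists_coloring
  exact Nat.sInf_le ⟨c, fun i hi s hs =>
    (hasTreeOrder_of_coloring hc i hi s hs _ fun _ hx => hx).treeDepth_induce_le⟩
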